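/- Let σ ∈ ℂ\{0}, p, q ∈ C¹([0,ℓ];ℝ), a ∈ C²([0,ℓ];ℝ) with a > 0 on [0,ℓ], and let K ∈ C²(closure Ω;ℝ) solve the Goursat problem associated with (a,p,q). Let u ∈ C^{1,2}([0,T]×[0,ℓ];ℂ) satisfy σ∂_t u − a(x)∂_x²u + p(x)u = 0 in (0,T)×(0,ℓ). Then the function ṽ(t,x) := u(t,x) + ∫₀ˣ K(x,y) u(t,y) dy satisfies σ∂_t ṽ − a(x)∂_x²ṽ + q(x)ṽ = −a(0)K(x,0)∂_x u(t,0) for 0<t<T, 0<x<ℓ, together with ∂_x ṽ(t,0) = ∂_x u(t,0) and ṽ(t,0) = u(t,0) for 0<t<T. -/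

import Mathlib

open Set MeasureTheory intervalIntegral

noncomputable section

/-- `u` is of class `C^{1,2}` on `[0,T] × [0,ℓ]`, with `ut`, `ux`, `uxx` its
partial derivatives `∂ₜu`, `∂ₓu`, `∂ₓ²u`. -/
def IsC12 (T ℓ : ℝ) (u ut ux uxx : ℝ → ℝ → ℂ) : Prop :=
  (∀ t ∈ Icc (0:ℝ) T, ∀ x ∈ Icc (0:ℝ) ℓ,
      HasDerivWithinAt (fun s => u s x) (ut t x) (Icc 0 T) t ∧
      HasDerivWithinAt (fun y => u t y) (ux t x) (Icc 0 ℓ) x ∧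
      HasDerivWithinAt (fun y => ux t y) (uxx t x) (Icc 0 ℓ) x) ∧
  ContinuousOn (fun z : ℝ × ℝ => u z.1 z.2) (Icc 0 T ×ˢ Icc 0 ℓ) ∧
  ContinuousOn (fun z : ℝ × ℝ => ut z.1 z.2) (Icc 0 T ×ˢ Icc 0 ℓ) ∧
  ContinuousOn (fun z : ℝ × ℝ => ux z.1 z.2) (Icc 0 T ×ˢ Icc 0 ℓ) ∧
  ContinuousOn (fun z : ℝ × ℝ => uxx z.1 z.2) (Icc 0 T ×ˢ Icc 0 ℓ)

/-- `K` solves the Goursat problem associated with `(a, p, q)` on the closed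
triangle `{0 ≤ y ≤ x ≤ ℓ}` (closure of `Ω = {0 < y < x < ℓ}`): it is `C²` on
the closed triangle, satisfies the hyperbolic equation
`a(x)∂ₓ²K − ∂_y²(a(y)K) = (q(x) − p(y))K` in `Ω`, the boundary condition
`a(0)∂_yK(x,0) + a'(0)K(x,0) = 0`, the diagonal condition
`2a(x)(d/dx)K(x,x) + a'(x)K(x,x) = q(x) − p(x)` for `0 < x < ℓ`, and `K(0,0)=0`. -/
def IsGoursatSol (ℓ : ℝ) (a p q : ℝ → ℝ) (K : ℝ → ℝ → ℝ) : Prop :=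
  ContDiffOn ℝ 2 (fun z : ℝ × ℝ => K z.1 z.2)
      {z : ℝ × ℝ | 0 ≤ z.2 ∧ z.2 ≤ z.1 ∧ z.1 ≤ ℓ} ∧
  (∀ x y : ℝ, 0 < y → y < x → x < ℓ →
      a x * deriv (fun s => deriv (fun s' => K s' y) s) x
        - deriv (fun s => deriv (fun s' => a s' * K x s') s) y
        = (q x - p y) * K x y) ∧
  (∀ x : ℝ, 0 < x → x < ℓ →
      a 0 * derivWithin (fun s => K x s) (Icc 0 x) 0
        + derivWithin a (Icc 0 ℓ) 0 * K x 0 = 0) ∧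
  (∀ x : ℝ, 0 < x → x < ℓ →
      2 * a x * derivWithin (fun s => K s s) (Icc 0 ℓ) x
        + derivWithin a (Icc 0 ℓ) x * K x x = q x - p x) ∧
  K 0 0 = 0

/-- The closed triangle `{0 ≤ y ≤ x ≤ ℓ}`. -/
def closedTriangle (ℓ : ℝ) : Set (ℝ × ℝ) := {z | 0 ≤ z.2 ∧ z.2 ≤ z.1 ∧ z.1 ≤ ℓ}

lemma isClosed_closedTriangle (ℓ : ℝ) : IsClosed (closedTriangle ℓ) :=
  (isClosed_le continuous_const continuous_snd).inter
    ((isClosed_le continuous_snd continuous_fst).inter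
      (isClosed_le continuous_fst continuous_const))

lemma ContinuousOn.exists_continuous_extension {X : Type*} [TopologicalSpace X] [NormalSpace X]
    {s : Set X} {f : X → ℂ} (hf : ContinuousOn f s) (hs : IsClosed s) :
    ∃ g : X → ℂ, Continuous g ∧ EqOn f g s := by
  obtain ⟨g, hg⟩ := ContinuousMap.exists_restrict_eq hs ⟨s.domRestrict f, hf.domRestrict⟩
  exact ⟨g, g.continuous, fun x hx => (DFunLike.congr_fun hg ⟨x, hx⟩).symm⟩

lemma integral_integral_triangle_swap {g : ℝ → ℝ → ℂ} (hg : Continuous (Function.uncurry g))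
    {x : ℝ} (hx : 0 ≤ x) :
    ∫ y in (0:ℝ)..x, ∫ s in y..x, g s y = ∫ s in (0:ℝ)..x, ∫ y in (0:ℝ)..s, g s y := by
  let h : ℝ → ℝ → ℂ := fun y s => {z : ℝ × ℝ | z.1 ≤ z.2}.indicator (fun z => g z.2 z.1) (y, s)
  have hm : MeasurableSet {z : ℝ × ℝ | z.1 ≤ z.2} := measurableSet_le measurable_fst measurable_snd
  have hint : Integrable (Function.uncurry h)
      ((volume.restrict (Ioc 0 x)).prod (volume.restrict (Ioc 0 x))) := by
    rw [Measure.prod_restrict]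
    have hc : Continuous fun z : ℝ × ℝ => g z.2 z.1 := by fun_prop
    refine Integrable.indicator (f := fun z : ℝ × ℝ => g z.2 z.1) ?_ hm
    exact (hc.continuousOn.integrableOn_compact (isCompact_Icc.prod isCompact_Icc)).mono_set
      (Set.prod_mono Ioc_subset_Icc_self Ioc_subset_Icc_self)
  rw [integral_of_le hx, integral_of_le hx]
  calc ∫ y in Ioc 0 x, ∫ s in y..x, g s y
      = ∫ y in Ioc 0 x, ∫ s in Ioc 0 x, h y s := by
        refine setIntegral_congr_fun measurableSet_Ioc fun y hy => ?_
        have : h y = (Ici y).indicator fun s => g s y := by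
          ext s; simp [h, indicator]
        simp only [this]
        rw [setIntegral_indicator measurableSet_Ici, integral_of_le hy.2,
          ← integral_Icc_eq_integral_Ioc]
        congr 2
        ext s; simp only [mem_Icc, mem_inter_iff, mem_Ioc, mem_Ici]
        exact ⟨fun k => ⟨⟨hy.1.trans_le k.1, k.2⟩, k.1⟩, fun k => ⟨k.2, k.1.2⟩⟩
    _ = ∫ s in Ioc 0 x, ∫ y in Ioc 0 x, h y s := integral_integral_swap hint
    _ = ∫ s in Ioc 0 x, ∫ y in (0:ℝ)..s, g s y := by
        refine setIntegral_congr_fun measurableSet_Ioc fun s hs => ?_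
        have : (fun y => h y s) = (Iic s).indicator fun y => g s y := by
          ext y; simp [h, indicator]
        simp only [this]
        rw [setIntegral_indicator measurableSet_Iic, integral_of_le hs.1.le]
        congr 2
        ext y; simp only [mem_inter_iff, mem_Ioc, mem_Iic]
        exact ⟨fun k => ⟨k.1.1, k.2⟩, fun k => ⟨⟨k.1, k.2.trans hs.2⟩, k.2⟩⟩

lemma integral_eq_sub_of_hasDerivWithinAt_Icc {f f' : ℝ → ℂ} {a b : ℝ} (hab : a ≤ b)
    (hf : ∀ x ∈ Icc a b, HasDerivWithinAt f (f' x) (Icc a b) x)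
    (hf' : ContinuousOn f' (Icc a b)) : ∫ x in a..b, f' x = f b - f a :=
  integral_eq_sub_of_hasDerivAt_of_le hab (fun x hx => (hf x hx).continuousWithinAt)
    (fun x hx => (hf x (Ioo_subset_Icc_self hx)).hasDerivAt (Icc_mem_nhds hx.1 hx.2))
    (hf'.intervalIntegrable_of_Icc hab)

/-- The Leibniz rule for `x ↦ ∫₀ˣ G(x,y) dy` when `G` is only defined on the closed triangle. -/
lemma hasDerivWithinAt_integral_closedTriangle {ℓ : ℝ} {G g : ℝ → ℝ → ℂ}
    (hdiag : ContinuousOn (fun x => G x x) (Icc 0 ℓ))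
    (hg : ContinuousOn (Function.uncurry g) (closedTriangle ℓ))
    (hG : ∀ y ∈ Icc 0 ℓ, ∀ x ∈ Icc y ℓ, HasDerivWithinAt (fun s => G s y) (g x y) (Icc y ℓ) x)
    {x : ℝ} (hx : x ∈ Icc 0 ℓ) :
    HasDerivWithinAt (fun x => ∫ y in (0:ℝ)..x, G x y)
      (G x x + ∫ y in (0:ℝ)..x, g x y) (Icc 0 ℓ) x := by
  obtain ⟨d, hdc, hd⟩ := hdiag.exists_continuous_extension isClosed_Icc
  obtain ⟨e, hec, he⟩ := hg.exists_continuous_extension (isClosed_closedTriangle ℓ)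
  let e' : ℝ → ℝ → ℂ := fun s y => e (s, y)
  have hec' : Continuous (Function.uncurry e') := hec
  have hprim : ∀ x ∈ Icc 0 ℓ, ∫ y in (0:ℝ)..x, G x y
      = ∫ s in (0:ℝ)..x, (d s + ∫ y in (0:ℝ)..s, e' s y) := by
    intro x hx
    have h1 : ∫ y in (0:ℝ)..x, G x y = ∫ y in (0:ℝ)..x, (d y + ∫ s in y..x, e' s y) := by
      refine integral_congr fun y hy => ?_
      rw [uIcc_of_le hx.1] at hy
      have hyl : y ∈ Icc 0 ℓ := ⟨hy.1, hy.2.trans hx.2⟩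
      have h2 : ∫ s in y..x, e' s y = ∫ s in y..x, g s y := by
        refine integral_congr fun s hs => ?_
        rw [uIcc_of_le hy.2] at hs
        exact (he (x := (s, y)) ⟨hy.1, hs.1, hs.2.trans hx.2⟩).symm
      have h3 : ∫ s in y..x, g s y = G x y - G y y := by
        refine integral_eq_sub_of_hasDerivWithinAt_Icc (f := fun s => G s y) hy.2
          (fun s hs => (hG y hyl s ⟨hs.1, hs.2.trans hx.2⟩).mono (Icc_subset_Icc_right hx.2)) ?_
        exact hg.comp (f := fun s => (s, y)) (by fun_prop)
          fun s hs => ⟨hy.1, hs.1, hs.2.trans hx.2⟩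
      simp only [h2, h3, ← hd hyl]; ring
    have hc1 : Continuous fun y => ∫ s in y..x, e' s y := by
      simp_rw [integral_symm x]
      fun_prop
    rw [h1, integral_add (hdc.intervalIntegrable _ _) (hc1.intervalIntegrable _ _),
      integral_integral_triangle_swap hec' hx.1, ← integral_add (hdc.intervalIntegrable _ _)]
    exact Continuous.intervalIntegrable (by fun_prop) _ _
  have hc : Continuous fun s => d s + ∫ y in (0:ℝ)..s, e' s y := by fun_prop
  have hder := (hc.integral_hasStrictDerivAt 0 x).hasDerivAt.hasDerivWithinAt (s := Icc 0 ℓ)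
  have hval : G x x + ∫ y in (0:ℝ)..x, g x y = d x + ∫ y in (0:ℝ)..x, e' x y := by
    rw [← hd hx]
    congr 1
    refine integral_congr fun y hy => ?_
    rw [uIcc_of_le hx.1] at hy
    exact he (x := (x, y)) ⟨hy.1, hy.2, hx.2⟩
  rw [hval]
  exact hder.congr hprim (hprim x hx)

/-- Joint continuity of `(t,x) ↦ ∫₀ˣ k(x,y) w(t,y) dy`. -/
lemma continuousOn_integral_kernel {T ℓ : ℝ} {k w : ℝ → ℝ → ℂ}
    (hk : ContinuousOn (Function.uncurry k) (closedTriangle ℓ))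
    (hw : ContinuousOn (Function.uncurry w) (Icc 0 T ×ˢ Icc 0 ℓ)) :
    ContinuousOn (fun z : ℝ × ℝ => ∫ y in (0:ℝ)..z.2, k z.2 y * w z.1 y)
      (Icc 0 T ×ˢ Icc 0 ℓ) := by
  obtain ⟨e, hec, he⟩ := hk.exists_continuous_extension (isClosed_closedTriangle ℓ)
  obtain ⟨f, hfc, hf⟩ := hw.exists_continuous_extension (isClosed_Icc.prod isClosed_Icc)
  have hc : Continuous fun z : ℝ × ℝ => ∫ y in (0:ℝ)..z.2, e (z.2, y) * f (z.1, y) := by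
    fun_prop
  refine hc.continuousOn.congr fun z hz => integral_congr fun y hy => ?_
  rw [uIcc_of_le hz.2.1] at hy
  exact congrArg₂ (· * ·) (he (x := (z.2, y)) ⟨hy.1, hy.2, hz.2.2⟩)
    (hf (x := (z.1, y)) ⟨hz.1, hy.1, hy.2.trans hz.2.2⟩)

/-- Differentiation of `∫₀ˣ k(y) w(t,y) dy` in the parameter `t`. -/
lemma hasDerivWithinAt_integral_param {T x : ℝ} (hx : 0 ≤ x) {k : ℝ → ℂ} {w wt : ℝ → ℝ → ℂ}
    (hk : ContinuousOn k (Icc 0 x))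
    (hw : ContinuousOn (Function.uncurry w) (Icc 0 T ×ˢ Icc 0 x))
    (hwt : ContinuousOn (Function.uncurry wt) (Icc 0 T ×ˢ Icc 0 x))
    (hder : ∀ t ∈ Icc 0 T, ∀ y ∈ Icc 0 x,
      HasDerivWithinAt (fun s => w s y) (wt t y) (Icc 0 T) t)
    {t : ℝ} (ht : t ∈ Icc 0 T) :
    HasDerivWithinAt (fun t => ∫ y in (0:ℝ)..x, k y * w t y)
      (∫ y in (0:ℝ)..x, k y * wt t y) (Icc 0 T) t := by
  obtain ⟨κ, hκc, hκ⟩ := hk.exists_continuous_extension isClosed_Icc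
  obtain ⟨f, hfc, hf⟩ := hwt.exists_continuous_extension (isClosed_Icc.prod isClosed_Icc)
  have hT : (0:ℝ) ∈ Icc 0 T := ⟨le_rfl, ht.1.trans ht.2⟩
  have hprim : ∀ t ∈ Icc 0 T, ∫ y in (0:ℝ)..x, k y * w t y
      = (∫ y in (0:ℝ)..x, k y * w 0 y)
        + ∫ s in (0:ℝ)..t, ∫ y in (0:ℝ)..x, κ y * f (s, y) := by
    intro t ht
    have hii : ∀ s ∈ Icc 0 T, IntervalIntegrable (fun y => k y * w s y) volume 0 x := fun s hs =>
      (hk.mul (hw.comp (f := fun y => (s, y)) (by fun_prop)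
        fun y hy => ⟨hs, hy⟩)).intervalIntegrable_of_Icc hx
    have hswap : ∫ s in (0:ℝ)..t, ∫ y in (0:ℝ)..x, κ y * f (s, y)
        = ∫ y in (0:ℝ)..x, ∫ s in (0:ℝ)..t, κ y * f (s, y) := by
      refine intervalIntegral_intervalIntegral_swap (F := fun s y => κ y * f (s, y)) ?_
      have hc : Continuous (Function.uncurry fun s y => κ y * f (s, y)) := by
        unfold Function.uncurry; fun_prop
      exact (hc.continuousOn.integrableOn_compact (isCompact_uIcc.prod isCompact_uIcc)).mono_set
        (Set.prod_mono uIoc_subset_uIcc uIoc_subset_uIcc)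
    rw [hswap, ← sub_eq_iff_eq_add', ← integral_sub (hii t ht) (hii 0 hT)]
    refine integral_congr fun y hy => ?_
    rw [uIcc_of_le hx] at hy
    have h1 : ∫ s in (0:ℝ)..t, f (s, y) = ∫ s in (0:ℝ)..t, wt s y := by
      refine integral_congr fun s hs => ?_
      rw [uIcc_of_le ht.1] at hs
      exact (hf (x := (s, y)) ⟨⟨hs.1, hs.2.trans ht.2⟩, hy⟩).symm
    have h2 : ∫ s in (0:ℝ)..t, wt s y = w t y - w 0 y := by
      have hsub : Icc 0 t ⊆ Icc 0 T := Icc_subset_Icc_right ht.2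
      exact integral_eq_sub_of_hasDerivWithinAt_Icc (f := fun s => w s y) ht.1
        (fun s hs => (hder s (hsub hs) y hy).mono hsub)
        (hwt.comp (f := fun s => (s, y)) (by fun_prop) fun s hs => ⟨hsub hs, hy⟩)
    simp only [intervalIntegral.integral_const_mul, h1, h2, ← hκ hy]; ring
  have hc : Continuous fun s => ∫ y in (0:ℝ)..x, κ y * f (s, y) := by fun_prop
  have hF := (hc.integral_hasStrictDerivAt 0 t).hasDerivAt.hasDerivWithinAt (s := Icc 0 T)
  have hval : ∫ y in (0:ℝ)..x, k y * wt t y = ∫ y in (0:ℝ)..x, κ y * f (t, y) := by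
    refine integral_congr fun y hy => ?_
    rw [uIcc_of_le hx] at hy
    exact congrArg₂ (· * ·) (hκ hy) (hf (x := (t, y)) ⟨ht, hy⟩)
  rw [hval]
  exact (hF.const_add _).congr hprim (hprim t ht)

lemma convex_closedTriangle (ℓ : ℝ) : Convex ℝ (closedTriangle ℓ) := by
  rintro ⟨x, y⟩ ⟨h1, h2, h3⟩ ⟨x', y'⟩ ⟨h1', h2', h3'⟩ α β hα hβ hαβ
  simp only at h1 h2 h3 h1' h2' h3'
  simp only [closedTriangle, mem_ofPred_eq, Prod.smul_mk, Prod.mk_add_mk, smul_eq_mul]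
  refine ⟨by positivity, by gcongr, ?_⟩
  calc α * x + β * x' ≤ α * ℓ + β * ℓ := by gcongr
    _ = ℓ := by rw [← add_mul, hαβ, one_mul]

lemma uniqueDiffOn_closedTriangle {ℓ : ℝ} (hℓ : 0 < ℓ) : UniqueDiffOn ℝ (closedTriangle ℓ) := by
  suffices h : (ℓ / 2, ℓ / 4) ∈ interior (closedTriangle ℓ) from
    uniqueDiffOn_convex (convex_closedTriangle ℓ) ⟨_, h⟩
  have hopen : IsOpen {z : ℝ × ℝ | 0 < z.2 ∧ z.2 < z.1 ∧ z.1 < ℓ} :=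
    (isOpen_lt continuous_const continuous_snd).inter
      ((isOpen_lt continuous_snd continuous_fst).inter
        (isOpen_lt continuous_fst continuous_const))
  have hsub : {z : ℝ × ℝ | 0 < z.2 ∧ z.2 < z.1 ∧ z.1 < ℓ} ⊆ closedTriangle ℓ :=
    fun z hz => ⟨hz.1.le, hz.2.1.le, hz.2.2.le⟩
  refine interior_maximal hsub hopen ?_
  refine ⟨?_, ?_, ?_⟩ <;> simp only <;> linarith

/-- The partial derivatives of a function that is `C^{n+1}` on the closed triangle. -/
lemma ContDiffOn.exists_partials_closedTriangle {ℓ : ℝ} (hℓ : 0 < ℓ) {n : ℕ} {f : ℝ → ℝ → ℝ}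
    (hf : ContDiffOn ℝ (n + 1) (Function.uncurry f) (closedTriangle ℓ)) :
    ∃ fx fy : ℝ → ℝ → ℝ,
      ContDiffOn ℝ n (Function.uncurry fx) (closedTriangle ℓ) ∧
      ContDiffOn ℝ n (Function.uncurry fy) (closedTriangle ℓ) ∧
      (∀ y ∈ Icc 0 ℓ, ∀ x ∈ Icc y ℓ,
        HasDerivWithinAt (fun s => f s y) (fx x y) (Icc y ℓ) x) ∧
      (∀ x ∈ Icc 0 ℓ, ∀ y ∈ Icc 0 x,
        HasDerivWithinAt (fun s => f x s) (fy x y) (Icc 0 x) y) ∧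
      (∀ x ∈ Icc 0 ℓ, HasDerivWithinAt (fun s => f s s) (fx x x + fy x x) (Icc 0 ℓ) x) := by
  set D := fderivWithin ℝ (Function.uncurry f) (closedTriangle ℓ) with hD
  have hDc : ContDiffOn ℝ n D (closedTriangle ℓ) :=
    hf.fderivWithin (uniqueDiffOn_closedTriangle hℓ) le_rfl
  have hder : ∀ z ∈ closedTriangle ℓ,
      HasFDerivWithinAt (Function.uncurry f) (D z) (closedTriangle ℓ) z := fun z hz =>
    (hf.differentiableOn (by simp) z hz).hasFDerivWithinAt
  refine ⟨fun x y => D (x, y) (1, 0), fun x y => D (x, y) (0, 1),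
    hDc.clm_apply contDiffOn_const, hDc.clm_apply contDiffOn_const, ?_, ?_, ?_⟩
  · intro y hy x hx
    exact (hder (x, y) ⟨hy.1, hx.1, hx.2⟩).comp_hasDerivWithinAt (f := fun s => (s, y)) x
      ((hasDerivWithinAt_id x _).prodMk (hasDerivWithinAt_const x _ y))
      fun s hs => ⟨hy.1, hs.1, hs.2⟩
  · intro x hx y hy
    exact (hder (x, y) ⟨hy.1, hy.2, hx.2⟩).comp_hasDerivWithinAt (f := fun s => (x, s)) y
      ((hasDerivWithinAt_const y _ x).prodMk (hasDerivWithinAt_id y _))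
      fun s hs => ⟨hs.1, hs.2, hx.2⟩
  · intro x hx
    have h := (hder (x, x) ⟨hx.1, le_rfl, hx.2⟩).comp_hasDerivWithinAt (f := fun s => (s, s)) x
      ((hasDerivWithinAt_id x (Icc 0 ℓ)).prodMk (hasDerivWithinAt_id x _))
      fun s hs => ⟨hs.1, le_rfl, hs.2⟩
    rw [← map_add]
    simpa [Function.comp_def] using h

/-- Green's identity on `[b,c]` for a real `C²` function and a complex `C²` function. -/
lemma ContDiffOn.integral_green {b c : ℝ} (hbc : b < c) {W : ℝ → ℝ}
    (hW : ContDiffOn ℝ 2 W (Icc b c)) {w w' w'' : ℝ → ℂ}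
    (hw : ∀ y ∈ Icc b c, HasDerivWithinAt w (w' y) (Icc b c) y)
    (hw' : ∀ y ∈ Icc b c, HasDerivWithinAt w' (w'' y) (Icc b c) y)
    (hw'' : ContinuousOn w'' (Icc b c)) :
    ∫ y in b..c, ((W y : ℂ) * w'' y - ((deriv (deriv W) y : ℝ) : ℂ) * w y)
      = ((W c : ℂ) * w' c - ((derivWithin W (Icc b c) c : ℝ) : ℂ) * w c)
        - ((W b : ℂ) * w' b - ((derivWithin W (Icc b c) b : ℝ) : ℂ) * w b) := by
  have hud : UniqueDiffOn ℝ (Icc b c) := uniqueDiffOn_Icc hbc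
  set W₁ := derivWithin W (Icc b c) with hW₁
  have hW₁c : ContDiffOn ℝ 1 W₁ (Icc b c) := hW.derivWithin hud (by norm_num)
  have hW₂c : ContinuousOn (derivWithin W₁ (Icc b c)) (Icc b c) :=
    hW₁c.continuousOn_derivWithin hud le_rfl
  have hd : ∀ y ∈ Icc b c, HasDerivWithinAt W (W₁ y) (Icc b c) y := fun y hy =>
    (hW.differentiableOn (by simp) y hy).hasDerivWithinAt
  have hd₁ : ∀ y ∈ Icc b c, HasDerivWithinAt W₁ (derivWithin W₁ (Icc b c) y) (Icc b c) y :=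
    fun y hy => (hW₁c.differentiableOn (by simp) y hy).hasDerivWithinAt
  have hWw : ContinuousOn (fun y => (W y : ℂ)) (Icc b c) :=
    Complex.continuous_ofReal.comp_continuousOn hW.continuousOn
  have hint := integral_eq_sub_of_hasDerivWithinAt_Icc
    (f := fun y => (W y : ℂ) * w' y - (W₁ y : ℂ) * w y)
    (f' := fun y => (W y : ℂ) * w'' y - ((derivWithin W₁ (Icc b c) y : ℝ) : ℂ) * w y) hbc.le
    (fun y hy => by
      convert! ((hd y hy).ofReal_comp.mul (hw' y hy)).sub ((hd₁ y hy).ofReal_comp.mul (hw y hy))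
        using 1
      ring)
    ((hWw.mul hw'').sub ((Complex.continuous_ofReal.comp_continuousOn hW₂c).mul
      fun y hy => (hw y hy).continuousWithinAt))
  rw [← hint]
  refine integral_congr_Ioo_of_le hbc.le fun y hy => ?_
  have h1 : deriv W =ᶠ[nhds y] W₁ := by
    filter_upwards [Ioo_mem_nhds hy.1 hy.2] with z hz
    exact (derivWithin_of_mem_nhds (Icc_mem_nhds hz.1 hz.2)).symm
  have h2 : deriv (deriv W) y = derivWithin W₁ (Icc b c) y := by
    rw [h1.deriv_eq, derivWithin_of_mem_nhds (Icc_mem_nhds hy.1 hy.2)]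
  simp only [h2]

/-- Lemma 2: the transformation `ṽ = u + Ku` sends a solution of the equation
with potential `p` to a solution of the equation with potential `q`, up to the
source term `−a(0)K(x,0)∂ₓu(t,0)`, preserving the Cauchy data at `x = 0`. -/
theorem stmt_5
    (T ℓ : ℝ) (hT : 0 < T) (hℓ : 0 < ℓ)
    (σ : ℂ) (hσ : σ ≠ 0)
    (p q a : ℝ → ℝ)
    (hp : ContDiffOn ℝ 1 p (Icc 0 ℓ)) (hq : ContDiffOn ℝ 1 q (Icc 0 ℓ))
    (ha : ContDiffOn ℝ 2 a (Icc 0 ℓ)) (hapos : ∀ x ∈ Icc (0:ℝ) ℓ, 0 < a x)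
    (K : ℝ → ℝ → ℝ) (hK : IsGoursatSol ℓ a p q K)
    (u ut ux uxx : ℝ → ℝ → ℂ) (hu : IsC12 T ℓ u ut ux uxx)
    (hpde : ∀ t ∈ Ioo (0:ℝ) T, ∀ x ∈ Ioo (0:ℝ) ℓ,
      σ * ut t x - a x * uxx t x + p x * u t x = 0)
    (v : ℝ → ℝ → ℂ)
    (hv : v = fun t x => u t x + ∫ y in (0:ℝ)..x, (K x y : ℂ) * u t y) :
    ∃ vt vx vxx : ℝ → ℝ → ℂ,
      IsC12 T ℓ v vt vx vxx ∧
      (∀ t ∈ Ioo (0:ℝ) T, ∀ x ∈ Ioo (0:ℝ) ℓ,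
        σ * vt t x - a x * vxx t x + q x * v t x
          = -((a 0 : ℂ) * (K x 0 : ℂ) * ux t 0)) ∧
      (∀ t ∈ Ioo (0:ℝ) T, vx t 0 = ux t 0 ∧ v t 0 = u t 0) := by
  obtain ⟨hKc, hKpde, hK0, hKd, hK00⟩ := hK
  obtain ⟨hder, huc, hutc, huxc, huxxc⟩ := hu
  have hKc : ContDiffOn ℝ 2 (Function.uncurry K) (closedTriangle ℓ) := hKc
  obtain ⟨Kx, Ky, hKxc, hKyc, hKx, hKy, hKdiag⟩ :=
    ContDiffOn.exists_partials_closedTriangle (n := 1) hℓ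
      (by norm_num [one_add_one_eq_two]; exact hKc)
  obtain ⟨Kxx, -, hKxxc, -, hKxx, -, -⟩ :=
    ContDiffOn.exists_partials_closedTriangle (n := 0) (f := Kx) hℓ (by simpa using hKxc)
  have hrow : ∀ {w : ℝ → ℝ → ℂ},
      ContinuousOn (fun z : ℝ × ℝ => w z.1 z.2) (Icc 0 T ×ˢ Icc 0 ℓ) →
      ∀ t ∈ Icc 0 T, ContinuousOn (w t) (Icc 0 ℓ) := fun hw t ht =>
    hw.comp (f := fun y => (t, y)) (by fun_prop) fun y hy => ⟨ht, hy⟩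
  have hcol : ∀ {k : ℝ → ℝ → ℂ}, ContinuousOn (Function.uncurry k) (closedTriangle ℓ) →
      ∀ x ∈ Icc 0 ℓ, ContinuousOn (k x) (Icc 0 x) := fun hk x hx =>
    hk.comp (f := fun y => (x, y)) (by fun_prop) fun y hy => ⟨hy.1, hy.2, hx.2⟩
  have hdiag : ∀ {k : ℝ → ℝ → ℂ}, ContinuousOn (Function.uncurry k) (closedTriangle ℓ) →
      ContinuousOn (fun x => k x x) (Icc 0 ℓ) := fun hk =>
    hk.comp (f := fun y => (y, y)) (by fun_prop) fun y hy => ⟨hy.1, le_rfl, hy.2⟩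
  have hdiag₂ : ∀ {k : ℝ → ℝ → ℂ}, ContinuousOn (Function.uncurry k) (closedTriangle ℓ) →
      ContinuousOn (fun z : ℝ × ℝ => k z.2 z.2) (Icc 0 T ×ˢ Icc 0 ℓ) := fun hk =>
    (hdiag hk).comp (f := Prod.snd) (by fun_prop) fun z hz => hz.2
  have hsnd : ∀ {k : ℝ → ℝ → ℂ} {w : ℝ → ℂ},
      ContinuousOn (Function.uncurry k) (closedTriangle ℓ) → ContinuousOn w (Icc 0 ℓ) →
      ContinuousOn (Function.uncurry fun x y => k x y * w y) (closedTriangle ℓ) := fun hk hw =>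
    hk.mul (hw.comp (f := Prod.snd) (by fun_prop) fun z hz => ⟨hz.1, hz.2.1.trans hz.2.2⟩)
  let k : ℝ → ℝ → ℂ := fun x y => (K x y : ℂ)
  let kx : ℝ → ℝ → ℂ := fun x y => (Kx x y : ℂ)
  let ky : ℝ → ℝ → ℂ := fun x y => (Ky x y : ℂ)
  let kxx : ℝ → ℝ → ℂ := fun x y => (Kxx x y : ℂ)
  have hkc : ContinuousOn (Function.uncurry k) (closedTriangle ℓ) :=
    Complex.continuous_ofReal.comp_continuousOn hKc.continuousOn
  have hkxc : ContinuousOn (Function.uncurry kx) (closedTriangle ℓ) :=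
    Complex.continuous_ofReal.comp_continuousOn hKxc.continuousOn
  have hkyc : ContinuousOn (Function.uncurry ky) (closedTriangle ℓ) :=
    Complex.continuous_ofReal.comp_continuousOn hKyc.continuousOn
  have hkxxc : ContinuousOn (Function.uncurry kxx) (closedTriangle ℓ) :=
    Complex.continuous_ofReal.comp_continuousOn hKxxc.continuousOn
  subst hv
  refine ⟨fun t x => ut t x + ∫ y in (0:ℝ)..x, k x y * ut t y,
    fun t x => ux t x + (k x x * u t x + ∫ y in (0:ℝ)..x, kx x y * u t y),
    fun t x => uxx t x + (((kx x x + ky x x) * u t x + k x x * ux t x)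
      + (kx x x * u t x + ∫ y in (0:ℝ)..x, kxx x y * u t y)),
    ⟨fun t ht x hx => ⟨?_, ?_, ?_⟩, ?_, ?_, ?_, ?_⟩, fun t ht x hx => ?_, fun t ht => ⟨?_, ?_⟩⟩
  · have hsub : Icc (0:ℝ) T ×ˢ Icc 0 x ⊆ Icc 0 T ×ˢ Icc 0 ℓ :=
      Set.prod_mono_right (Icc_subset_Icc_right hx.2)
    exact (hder t ht x hx).1.add (hasDerivWithinAt_integral_param hx.1 (hcol hkc x hx)
      (huc.mono hsub) (hutc.mono hsub)
      (fun s hs y hy => (hder s hs y ⟨hy.1, hy.2.trans hx.2⟩).1) ht)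
  · exact (hder t ht x hx).2.1.add (hasDerivWithinAt_integral_closedTriangle
      (G := fun x y => k x y * u t y) ((hdiag hkc).mul (hrow huc t ht))
      (hsnd hkxc (hrow huc t ht))
      (fun y hy x hx => (hKx y hy x hx).ofReal_comp.mul_const _) hx)
  · exact (hder t ht x hx).2.2.add (((hKdiag x hx).ofReal_comp.mul (hder t ht x hx).2.1
      |>.congr_deriv (by simp [k, kx, ky])).add (hasDerivWithinAt_integral_closedTriangle
      (G := fun x y => kx x y * u t y) ((hdiag hkxc).mul (hrow huc t ht))
      (hsnd hkxxc (hrow huc t ht))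
      (fun y hy x hx => (hKxx y hy x hx).ofReal_comp.mul_const _) hx))
  · exact huc.add (continuousOn_integral_kernel hkc huc)
  · exact hutc.add (continuousOn_integral_kernel hkc hutc)
  · exact huxc.add (((hdiag₂ hkc).mul huc).add (continuousOn_integral_kernel hkxc huc))
  · exact huxxc.add (((((hdiag₂ hkxc).add (hdiag₂ hkyc)).mul huc).add
      ((hdiag₂ hkc).mul huxc)).add
      (((hdiag₂ hkxc).mul huc).add (continuousOn_integral_kernel hkxxc huc)))
  · have htI := Ioo_subset_Icc_self ht
    have hxI := Ioo_subset_Icc_self hx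
    have hsub : Icc 0 x ⊆ Icc 0 ℓ := Icc_subset_Icc_right hx.2.le
    have h0x : (0:ℝ) ∈ Icc 0 x := ⟨le_rfl, hx.1.le⟩
    have hxx : x ∈ Icc 0 x := ⟨hx.1.le, le_rfl⟩
    have hKrow : ContDiffOn ℝ 2 (K x) (Icc 0 x) :=
      hKc.comp (f := fun y => (x, y)) (by fun_prop) fun y hy => ⟨hy.1, hy.2, hx.2.le⟩
    have hW : ContDiffOn ℝ 2 (fun y => a y * K x y) (Icc 0 x) := (ha.mono hsub).mul hKrow
    have hud := uniqueDiffOn_Icc hx.1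
    have ha' : ∀ y ∈ Icc 0 x, HasDerivWithinAt a (derivWithin a (Icc 0 ℓ) y) (Icc 0 x) y :=
      fun y hy => ((ha.differentiableOn (by simp)) y (hsub hy)).hasDerivWithinAt.mono hsub
    have hW₁ : ∀ y ∈ Icc 0 x, derivWithin (fun y => a y * K x y) (Icc 0 x) y
        = derivWithin a (Icc 0 ℓ) y * K x y + a y * Ky x y := fun y hy =>
      ((ha' y hy).mul (hKy x hxI y hy)).derivWithin (hud y hy)
    have hgreen := hW.integral_green hx.1
      (fun y hy => (hder t htI y (hsub hy)).2.1.mono hsub)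
      (fun y hy => (hder t htI y (hsub hy)).2.2.mono hsub)
      ((hrow huxxc t htI).mono hsub)
    rw [hW₁ 0 h0x, hW₁ x hxx] at hgreen
    have hbd : derivWithin a (Icc 0 ℓ) 0 * K x 0 + a 0 * Ky x 0 = 0 := by
      have h := hK0 x hx.1 hx.2
      rw [(hKy x hxI 0 h0x).derivWithin (hud 0 h0x)] at h
      linear_combination h
    have hdg := hKd x hx.1 hx.2
    rw [(hKdiag x hxI).derivWithin (uniqueDiffOn_Icc hℓ x hxI)] at hdg
    have hker : ∀ y ∈ Ioo 0 x, a x * Kxx x y - deriv (deriv fun y => a y * K x y) y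
        = (q x - p y) * K x y := by
      intro y hy
      have hKx' : ∀ s ∈ Ioo y ℓ, HasDerivAt (fun s => K s y) (Kx s y) s := fun s hs =>
        (hKx y ⟨hy.1.le, hy.2.le.trans hx.2.le⟩ s (Ioo_subset_Icc_self hs)).hasDerivAt
          (Icc_mem_nhds hs.1 hs.2)
      have hKxx' : HasDerivAt (fun s => Kx s y) (Kxx x y) x :=
        (hKxx y ⟨hy.1.le, hy.2.le.trans hx.2.le⟩ x ⟨hy.2.le, hx.2.le⟩).hasDerivAt
          (Icc_mem_nhds hy.2 hx.2)
      have heq : (fun s => deriv (fun s' => K s' y) s) =ᶠ[nhds x] fun s => Kx s y := by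
        filter_upwards [Ioo_mem_nhds hy.2 hx.2] with s hs using (hKx' s hs).deriv
      have h := hKpde x y hy.1 hy.2 hx.2
      rwa [heq.deriv_eq, hKxx'.deriv] at h
    have hii : ∀ {κ : ℝ → ℝ → ℂ} {w : ℝ → ℝ → ℂ},
        ContinuousOn (Function.uncurry κ) (closedTriangle ℓ) →
        ContinuousOn (fun z : ℝ × ℝ => w z.1 z.2) (Icc 0 T ×ˢ Icc 0 ℓ) →
        IntervalIntegrable (fun y => κ x y * w t y) volume 0 x := fun hκ hw =>
      ((hcol hκ x hxI).mul ((hrow hw t htI).mono hsub)).intervalIntegrable_of_Icc hx.1.le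
    have hmain : σ * (∫ y in (0:ℝ)..x, k x y * ut t y) - a x * (∫ y in (0:ℝ)..x, kxx x y * u t y)
        + q x * (∫ y in (0:ℝ)..x, k x y * u t y)
        = ∫ y in (0:ℝ)..x, (((a y * K x y : ℝ) : ℂ) * uxx t y
          - ((deriv (deriv fun y => a y * K x y) y : ℝ) : ℂ) * u t y) := by
      rw [← intervalIntegral.integral_const_mul, ← intervalIntegral.integral_const_mul,
        ← intervalIntegral.integral_const_mul,
        ← integral_sub ((hii hkc hutc).const_mul _) ((hii hkxxc huc).const_mul _),
        ← integral_add (((hii hkc hutc).const_mul _).sub ((hii hkxxc huc).const_mul _))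
          ((hii hkc huc).const_mul _)]
      refine integral_congr_Ioo_of_le hx.1.le fun y hy => ?_
      have h1 := hpde t ht y ⟨hy.1, hy.2.trans hx.2⟩
      have h2 : (a x : ℂ) * Kxx x y - ((deriv (deriv fun y => a y * K x y) y : ℝ) : ℂ)
        = (q x - p y) * K x y := mod_cast hker y hy
      simp only [k, kxx, Complex.ofReal_mul]
      linear_combination (K x y : ℂ) * h1 - u t y * h2
    have hbd' : (derivWithin a (Icc 0 ℓ) 0 : ℝ) * (K x 0 : ℂ) + a 0 * Ky x 0 = 0 := mod_cast hbd
    have hdg' : 2 * (a x : ℂ) * (Kx x x + Ky x x) + (derivWithin a (Icc 0 ℓ) x : ℝ) * K x x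
      = q x - p x := mod_cast hdg
    rw [hgreen] at hmain
    push_cast at hmain
    have h1 := hpde t ht x hx
    simp only [k, kx, ky, kxx] at hmain ⊢
    linear_combination hmain + h1 - u t x * hdg' + u t 0 * hbd'
  · simp [k, hK00]
  · simp
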